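/- arXiv:math/0409609 — 6 statements merged into one kernel-verified Lean document; each statement's English description precedes it below -/
import Mathlib

section
/- Let F be a filter on a set X. The following are equivalent: (1) F is countably fan-tight; (2) for every countable family (E_k)_{k∈ω} of subsets of X with E_k # F for all k, there exist finite sets B_k ⊆ E_k such that (⋃_{k≥n} B_k) # F for every n ∈ ω; (3) property (2) restricted to decreasing families E_0 ⊇ E_1 ⊇ ⋯; (4) F † H for every proper countably based filter H on X (F ∈ F_ω^†); (5) F † A for every subset A of X (F ∈ F_1^†). -/
open Filter Set

variable {X : Type*}

/-- Two filters mesh if all their members intersect, i.e. the filter generated by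
pairwise intersections (which is `F ⊓ G` in Mathlib's order) is proper. -/
def Mesh (F G : Filter X) : Prop := Filter.NeBot (F ⊓ G)

/-- The `†` relation on filters: `F † H` iff for every countable family of sets,
each meshing with `F ∨ H` (i.e. `F ⊓ H`), one can pick finite subsets whose union
meshes with `F ∨ H`. -/
def Dagger (F H : Filter X) : Prop :=
  ∀ A : ℕ → Set X, (∀ n, Mesh (𝓟 (A n)) (F ⊓ H)) →
    ∃ B : ℕ → Set X, (∀ n, B n ⊆ A n ∧ (B n).Finite) ∧ Mesh (𝓟 (⋃ n, B n)) (F ⊓ H)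

/-- `F` is countably fan-tight. -/
def CountablyFanTight (F : Filter X) : Prop :=
  ∀ A : ℕ → Set X, (∀ n, Mesh (𝓟 (A n)) F) →
    ∃ B : ℕ → Set X, (∀ n, B n ⊆ A n ∧ (B n).Finite) ∧ Mesh (𝓟 (⋃ n, B n)) F

theorem mesh_principal_iff {A : Set X} {F : Filter X} :
    Mesh (𝓟 A) F ↔ ∃ᶠ x in F, x ∈ A := by
  rw [Mesh, inf_comm, frequently_mem_iff_neBot]

theorem mesh_principal_inf_iff {A : Set X} {F H : Filter X} {h : ℕ → Set X}
    (hH : H.HasAntitoneBasis h) :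
    Mesh (𝓟 A) (F ⊓ H) ↔ ∀ n, ∃ᶠ x in F, x ∈ A ∧ x ∈ h n := by
  rw [mesh_principal_iff, (F.basis_sets.inf hH.toHasBasis).frequently_iff]
  simp only [frequently_iff, Prod.forall, id, mem_inter_iff]
  constructor
  · intro hA n U hU
    obtain ⟨x, ⟨hxU, hxn⟩, hxA⟩ := hA U n ⟨hU, trivial⟩
    exact ⟨x, hxU, hxA, hxn⟩
  · intro hA U n hU
    obtain ⟨x, hxU, hxA, hxn⟩ := hA n hU.1
    exact ⟨x, ⟨hxU, hxn⟩, hxA⟩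

/-- The property of a countably fan-tight filter can be strengthened so that every tail of the
chosen finite sets meshes with the filter. -/
theorem CountablyFanTight.exists_tails_mesh {F : Filter X} (hF : CountablyFanTight F)
    (E : ℕ → Set X) (hE : ∀ k, Mesh (𝓟 (E k)) F) :
    ∃ B : ℕ → Set X, (∀ k, B k ⊆ E k ∧ (B k).Finite) ∧
      ∀ n, Mesh (𝓟 (⋃ k, ⋃ (_ : n ≤ k), B k)) F := by
  choose C hC hCF using fun n => hF (fun k => E (n + k)) fun k => hE (n + k)
  refine ⟨fun k => ⋃ n ∈ Iic k, C n (k - n), fun k => ⟨?_, ?_⟩, fun n => ?_⟩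
  · refine iUnion₂_subset fun n hn => ?_
    simpa only [Nat.add_sub_cancel' (mem_Iic.mp hn)] using (hC n (k - n)).1
  · exact (finite_Iic k).biUnion fun n _ => (hC n (k - n)).2
  · rw [mesh_principal_iff]
    refine (mesh_principal_iff.mp (hCF n)).mono fun x hx => ?_
    obtain ⟨k, hk⟩ := mem_iUnion.mp hx
    refine mem_iUnion₂.mpr ⟨n + k, Nat.le_add_right n k, mem_iUnion₂.mpr ⟨n, ?_, ?_⟩⟩
    · exact Nat.le_add_right n k
    · simpa only [Nat.add_sub_cancel_left] using hk

theorem dagger_of_antitone_tails_mesh {F H : Filter X} [H.IsCountablyGenerated]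
    (hF : ∀ E : ℕ → Set X, Antitone E → (∀ k, Mesh (𝓟 (E k)) F) →
      ∃ B : ℕ → Set X, (∀ k, B k ⊆ E k ∧ (B k).Finite) ∧
        ∀ n, Mesh (𝓟 (⋃ k, ⋃ (_ : n ≤ k), B k)) F) :
    Dagger F H := by
  intro A hA
  obtain ⟨h, hH⟩ := H.exists_antitone_basis
  obtain ⟨B, hB, hBF⟩ := hF (fun k => ⋃ j ∈ Ici k, A j ∩ h j)
    (fun _ _ hkl => biUnion_subset_biUnion_left (Ici_subset_Ici.mpr hkl))
    (fun k => mesh_principal_iff.mpr <|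
      ((mesh_principal_inf_iff hH).mp (hA k) k).mono fun x hx =>
        mem_iUnion₂.mpr ⟨k, self_mem_Ici, hx⟩)
  refine ⟨fun j => (⋃ k ∈ Iic j, B k) ∩ A j, fun j => ⟨inter_subset_right, ?_⟩, ?_⟩
  · exact ((finite_Iic j).biUnion fun k _ => (hB k).2).inter_of_left _
  · refine (mesh_principal_inf_iff hH).mpr fun n =>
      (mesh_principal_iff.mp (hBF n)).mono fun x hx => ?_
    obtain ⟨k, hnk, hxk⟩ := mem_iUnion₂.mp hx
    obtain ⟨j, hkj, hxA, hxh⟩ := mem_iUnion₂.mp ((hB k).1 hxk)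
    exact ⟨mem_iUnion.mpr ⟨j, mem_iUnion₂.mpr ⟨k, hkj, hxk⟩, hxA⟩,
      hH.antitone (hnk.trans hkj) hxh⟩

theorem stmt0 (F : Filter X) :
    List.TFAE [
      -- (1) F is countably fan-tight
      CountablyFanTight F,
      -- (2) tails of the chosen finite sets mesh with F
      ∀ E : ℕ → Set X, (∀ k, Mesh (𝓟 (E k)) F) →
        ∃ B : ℕ → Set X, (∀ k, B k ⊆ E k ∧ (B k).Finite) ∧
          ∀ n, Mesh (𝓟 (⋃ k, ⋃ (_ : n ≤ k), B k)) F,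
      -- (3) same as (2) for decreasing families
      ∀ E : ℕ → Set X, Antitone E → (∀ k, Mesh (𝓟 (E k)) F) →
        ∃ B : ℕ → Set X, (∀ k, B k ⊆ E k ∧ (B k).Finite) ∧
          ∀ n, Mesh (𝓟 (⋃ k, ⋃ (_ : n ≤ k), B k)) F,
      -- (4) F ∈ F_ω^†
      ∀ H : Filter X, H.NeBot → H.IsCountablyGenerated → Dagger F H,
      -- (5) F ∈ F_1^†
      ∀ A : Set X, Dagger F (𝓟 A)] := by
  tfae_have 1 → 2 := fun hF => hF.exists_tails_mesh
  tfae_have 2 → 3 := fun hF E _ => hF E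
  tfae_have 3 → 4 := fun hF H _ _ => dagger_of_antitone_tails_mesh hF
  tfae_have 4 → 5 := by
    intro hF A
    rcases A.eq_empty_or_nonempty with rfl | hA
    · intro E hE
      exact absurd (hE 0) (by simp [Mesh])
    · exact hF (𝓟 A) (principal_neBot_iff.mpr hA) inferInstance
  tfae_have 5 → 1 := by
    intro hF
    simpa only [CountablyFanTight, Dagger, principal_univ, inf_top_eq] using hF univ
  tfae_finish
end

section
/- Let X be a set, let ⋆ and □ be sup-compatible relations on the filters on X, and let J and D be classes of filters on X such that J is D-steady. Then J^⋆ is D-steady and (J^⋆)^□ is D-steady. -/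
open Filter Set

variable {X : Type*}

/-- A relation on the filters on `X` is sup-compatible if it is symmetric, holds for
non-meshing pairs, and satisfies `F ⋆ (G ∨ H) → (F ∨ H) ⋆ G` when `G # F` and `F # H`
(the paper's `∨` of filters is Mathlib's `⊓`). -/
def SupCompatible (r : Filter X → Filter X → Prop) : Prop :=
  (∀ F G, r F G → r G F) ∧
  (∀ F G, ¬ Mesh F G → r F G) ∧
  (∀ F G H, Mesh G F → Mesh F H → r F (G ⊓ H) → r (F ⊓ H) G)

/-- The polar `J^⋆` of a class of filters. -/
def polar (r : Filter X → Filter X → Prop) (J : Set (Filter X)) : Set (Filter X) :=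
  {F | ∀ G ∈ J, r F G}

/-- `J` is `(D, M)`-steady. -/
def Steady (J D M : Set (Filter X)) : Prop :=
  ∀ F ∈ J, ∀ H ∈ D, Mesh F H → F ⊓ H ∈ M

theorem Mesh.symm {F G : Filter X} (h : Mesh F G) : Mesh G F := by
  rwa [Mesh, inf_comm]

theorem Mesh.mono {F F' G G' : Filter X} (h : Mesh F G) (hF : F ≤ F') (hG : G ≤ G') :
    Mesh F' G' :=
  Filter.NeBot.mono h (inf_le_inf hF hG)

/-- The polar of a `D`-steady class under a sup-compatible relation is `D`-steady. -/
theorem Steady.polar {r : Filter X → Filter X → Prop} {J D : Set (Filter X)}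
    (hr : SupCompatible r) (hJ : Steady J D J) : Steady (polar r J) D (polar r J) := by
  obtain ⟨-, hnot, hsup⟩ := hr
  intro F hF H hH hFH G hG
  by_cases h : Mesh (F ⊓ H) G
  · have hGF : Mesh G F := (h.mono inf_le_left le_rfl).symm
    have hGH : Mesh G H := (h.mono inf_le_right le_rfl).symm
    exact hsup F G H hGF hFH (hF _ (hJ G hG H hH hGH))
  · exact hnot _ _ h

theorem stmt1 (star square : Filter X → Filter X → Prop)
    (hstar : SupCompatible star) (hsquare : SupCompatible square)
    (J D : Set (Filter X)) (hJD : Steady J D J) :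
    Steady (polar star J) D (polar star J) ∧
    Steady (polar square (polar star J)) D (polar square (polar star J)) :=
  ⟨hJD.polar hstar, (hJD.polar hstar).polar hsquare⟩
end

section
/- Let X be a set, ⋆ a sup-compatible relation on the filters on X, and J a steady class of filters on X containing all principal filters. For any filter F on X the following are equivalent: (a) F ∈ J^⋆; (b) for every G ∈ J with G # F, F ∨ G ∈ F_1^⋆; (c) for every G ∈ J with G # F, F ∨ G ∈ J^⋆; (d) for every G ∈ J^{⋆⋆} with G # F, F ∨ G ∈ J^⋆. -/
open Filter Set

variable {X : Type*}

/-- The class of principal filters on `X`. -/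
def F1 : Set (Filter X) := {G | ∃ A : Set X, G = 𝓟 A}

theorem inf_mem_polar {star : Filter X → Filter X → Prop} (hstar : SupCompatible star)
    {J : Set (Filter X)} (hJ : Steady J J J) {F G : Filter X} (hF : F ∈ polar star J)
    (hG : G ∈ J) (hGF : Mesh G F) : F ⊓ G ∈ polar star J := by
  intro K hK
  by_cases h : Mesh (F ⊓ G) K
  · have hKG : Mesh K G := (h.mono inf_le_right le_rfl).symm
    exact hstar.2.2 F K G (h.mono inf_le_left le_rfl).symm hGF.symm (hF _ (hJ K hK G hG hKG))
  · exact hstar.2.1 _ _ h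

theorem SupCompatible.of_inf_top {star : Filter X → Filter X → Prop}
    (hstar : SupCompatible star) {F G : Filter X} (hFG : Mesh F G) (h : star (F ⊓ G) ⊤) :
    star F G := by
  have := hstar.2.2 ⊤ F G (hFG.mono le_rfl le_top) (hFG.mono le_top le_rfl) (hstar.1 _ _ h)
  rw [top_inf_eq] at this
  exact hstar.1 _ _ this

theorem subset_polar_polar {star : Filter X → Filter X → Prop} (hstar : SupCompatible star)
    (J : Set (Filter X)) : J ⊆ polar star (polar star J) :=
  fun _ hG _ hH => hstar.1 _ _ (hH _ hG)

theorem stmt3 (star : Filter X → Filter X → Prop) (hstar : SupCompatible star)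
    (J : Set (Filter X)) (hJ : Steady J J J) (hJ1 : F1 ⊆ J) (F : Filter X) :
    List.TFAE [
      -- (a) F ∈ J^⋆
      F ∈ polar star J,
      -- (b) ∀ G ∈ J meshing F, F ∨ G ∈ F_1^⋆
      ∀ G ∈ J, Mesh G F → F ⊓ G ∈ polar star F1,
      -- (c) ∀ G ∈ J meshing F, F ∨ G ∈ J^⋆
      ∀ G ∈ J, Mesh G F → F ⊓ G ∈ polar star J,
      -- (d) ∀ G ∈ J^{⋆⋆} meshing F, F ∨ G ∈ J^⋆
      ∀ G ∈ polar star (polar star J), Mesh G F → F ⊓ G ∈ polar star J] := by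
  tfae_have 1 → 4 := by
    intro hF G hG hGF K hK
    by_cases h : Mesh (F ⊓ G) K
    · have hKF : Mesh K F := (h.mono inf_le_left le_rfl).symm
      rw [inf_comm]
      refine hstar.2.2 G K F (h.mono inf_le_right le_rfl).symm hGF ?_
      rw [inf_comm]
      exact hG _ (inf_mem_polar hstar hJ hF hK hKF)
    · exact hstar.2.1 _ _ h
  tfae_have 4 → 3 := fun h G hG => h G (subset_polar_polar hstar J hG)
  tfae_have 3 → 2 := fun h G hG hGF K hK => h G hG hGF K (hJ1 hK)
  tfae_have 2 → 1 := by
    intro h G hG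
    by_cases hFG : Mesh F G
    · exact hstar.of_inf_top hFG (h G hG hFG.symm ⊤ ⟨univ, principal_univ.symm⟩)
    · exact hstar.2.1 _ _ hFG
  tfae_finish
end

section
/- A filter F on a set X belongs to F_1^{△△} — that is, for every Fréchet filter H on X with H # F there exists a proper countably based filter refining F ∨ H — if and only if F is almost principal, i.e., there exists F₀ ∈ F such that F₀ \ F' is finite for every F' ∈ F. -/
open Filter Set

variable {X : Type*}

/-- The `△` relation: `F △ H` iff whenever `H` meshes `F` there is a proper countably
based filter refining `F ∨ H` (i.e. `≤ F ⊓ H` in Mathlib's order). -/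
def Triangle (F H : Filter X) : Prop :=
  Mesh H F → ∃ L : Filter X, L.NeBot ∧ L.IsCountablyGenerated ∧ L ≤ F ⊓ H

/-- Fréchet filters: `F △ A` for every subset `A`, i.e. `F ∈ F_1^△`. -/
def Frechet (F : Filter X) : Prop := ∀ A : Set X, Triangle F (𝓟 A)

/-- `F` is almost principal if some `F₀ ∈ F` is almost contained in every member of `F`. -/
def AlmostPrincipal (F : Filter X) : Prop :=
  ∃ F₀ ∈ F, ∀ F' ∈ F, (F₀ \ F').Finite

/-- A supremum of countably generated filters is Fréchet. -/
theorem frechet_iSup {ι : Sort*} (G : ι → Filter X) (hG : ∀ i, (G i).IsCountablyGenerated) :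
    Frechet (⨆ i, G i) := by
  intro A hA
  rw [Mesh, inf_comm, ← iSup_inf_principal, iSup_neBot] at hA
  obtain ⟨i, hi⟩ := hA
  exact ⟨G i ⊓ 𝓟 A, hi, inferInstance, inf_le_inf_right _ (le_iSup G i)⟩

theorem le_cofinite_of_ker_eq_empty {L : Filter X} (h : L.ker = ∅) : L ≤ cofinite := by
  rw [le_cofinite_iff_compl_singleton_mem]
  intro x
  have hx : x ∉ L.ker := by simp [h]
  rw [mem_ker] at hx
  push Not at hx
  obtain ⟨s, hs, hxs⟩ := hx
  exact mem_of_superset hs (subset_compl_singleton_iff.2 hxs)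

theorem cofinite_inf_principal_le {F : Filter X} {F₀ : Set X}
    (h : ∀ F' ∈ F, (F₀ \ F').Finite) : cofinite ⊓ 𝓟 F₀ ≤ F := by
  intro F' hF'
  rw [mem_inf_principal, mem_cofinite]
  refine (h F' hF').subset fun x hx => ?_
  simpa using hx

theorem AlmostPrincipal.triangle {F H : Filter X} (hF : AlmostPrincipal F) (hH : Frechet H) :
    Triangle F H := by
  intro hHF
  obtain ⟨F₀, hF₀, hfin⟩ := hF
  have hle := cofinite_inf_principal_le hfin
  by_cases hker : (F.ker ∩ H.ker).Nonempty
  · obtain ⟨x, hxF, hxH⟩ := hker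
    exact ⟨pure x, inferInstance, inferInstance,
      le_inf (pure_le_iff.2 fun s hs => mem_ker.1 hxF s hs)
        (pure_le_iff.2 fun s hs => mem_ker.1 hxH s hs)⟩
  by_cases hinf : (H.ker ∩ F₀).Infinite
  · let u := hinf.natEmbedding
    let v : ℕ → X := fun n => u n
    have hv : Function.Injective v := Subtype.val_injective.comp u.injective
    refine ⟨map v atTop, inferInstance, inferInstance, le_inf (le_trans (le_inf ?_ ?_) hle) ?_⟩
    · rw [← Nat.cofinite_eq_atTop]
      exact hv.tendsto_cofinite
    · exact le_principal_iff.2 (mem_map.2 (univ_mem' fun n => (u n).2.2))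
    · exact fun s hs => mem_map.2 (univ_mem' fun n => mem_ker.1 (u n).2.1 s hs)
  · have hfin' : (H.ker ∩ F₀).Finite := not_infinite.1 hinf
    have hF₁ : F₀ \ H.ker ∈ F := by
      have hmem : (H.ker ∩ F₀)ᶜ ∈ F := by
        rw [← biUnion_of_singleton (H.ker ∩ F₀), compl_iUnion₂, biInter_mem hfin']
        intro x hx
        have hxF : x ∉ F.ker := fun h => hker ⟨x, h, hx.1⟩
        rw [mem_ker] at hxF
        push Not at hxF
        obtain ⟨s, hs, hxs⟩ := hxF
        exact mem_of_superset hs (subset_compl_singleton_iff.2 hxs)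
      filter_upwards [hF₀, hmem] with x hx hx' using ⟨hx, fun h => hx' ⟨h, hx⟩⟩
    obtain ⟨L, hL, hLc, hLle⟩ := hH (F₀ \ H.ker) <| by
      rw [Mesh, inf_comm]
      exact NeBot.mono hHF (inf_le_inf_left _ (le_principal_iff.2 hF₁))
    have hLH : L ≤ H := hLle.trans inf_le_left
    have hLF₁ : F₀ \ H.ker ∈ L := le_principal_iff.1 (hLle.trans inf_le_right)
    have hLker : L.ker = ∅ := eq_empty_of_forall_notMem fun x hx =>
      (mem_ker.1 hx _ hLF₁).2 (mem_ker.2 fun s hs => mem_ker.1 hx s (hLH hs))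
    exact ⟨L, hL, hLc, le_inf ((le_inf (le_cofinite_of_ker_eq_empty hLker)
      (le_principal_iff.2 (mem_of_superset hLF₁ sdiff_subset))).trans hle) hLH⟩

/-- The supremum of the filters of all injective sequences avoiding some member of `F`. -/
def avoidingFilter (F : Filter X) : Filter X :=
  ⨆ u : {u : ℕ → X // Function.Injective u ∧ ∃ F' ∈ F, ∀ n, u n ∉ F'}, map u.1 atTop

theorem mem_avoidingFilter {F : Filter X} {s : Set X} :
    s ∈ avoidingFilter F ↔ ∀ u : ℕ → X, Function.Injective u →
      (∃ F' ∈ F, ∀ n, u n ∉ F') → ∀ᶠ n in atTop, u n ∈ s := by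
  simp only [avoidingFilter, mem_iSup, mem_map, Subtype.forall, and_imp]
  rfl

theorem frechet_avoidingFilter (F : Filter X) : Frechet (avoidingFilter F) :=
  frechet_iSup _ fun _ => inferInstance

theorem mesh_avoidingFilter {F : Filter X} (hF : ¬ AlmostPrincipal F) :
    Mesh (avoidingFilter F) F := by
  rw [Mesh, inf_neBot_iff]
  intro s hs F₀ hF₀
  simp only [AlmostPrincipal] at hF
  push Not at hF
  obtain ⟨F', hF', hinf⟩ := hF F₀ hF₀
  let u := Set.Infinite.natEmbedding _ hinf
  obtain ⟨n, hn⟩ := (mem_avoidingFilter.1 hs (fun n => u n)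
    (Subtype.val_injective.comp u.injective) ⟨F', hF', fun n => (u n).2.2⟩).exists
  exact ⟨u n, hn, (u n).2.1⟩

/-- The range of a sequence converging to `F` is missed by the avoiding filter. -/
theorem compl_range_mem_avoidingFilter {F : Filter X} {x : ℕ → X} (hx : Tendsto x atTop F) :
    (range x)ᶜ ∈ avoidingFilter F := by
  refine mem_avoidingFilter.2 fun u hu ⟨F', hF', huF'⟩ => ?_
  obtain ⟨N, hN⟩ := eventually_atTop.1 (hx hF')
  rw [← Nat.cofinite_eq_atTop]
  refine (((finite_Iio N).image x).preimage hu.injOn).subset ?_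
  intro n hn
  obtain ⟨k, hk⟩ : u n ∈ range x := by simpa using hn
  refine ⟨k, mem_Iio.2 <| lt_of_not_ge fun h => huF' n ?_, hk⟩
  rw [← hk]
  exact hN k h

theorem not_triangle_avoidingFilter {F : Filter X} (hF : ¬ AlmostPrincipal F) :
    ¬ Triangle F (avoidingFilter F) := by
  intro h
  obtain ⟨L, hL, hLc, hLle⟩ := h (mesh_avoidingFilter hF)
  obtain ⟨x, hx⟩ := exists_seq_tendsto L
  have hmem := compl_range_mem_avoidingFilter (hx.mono_right (hLle.trans inf_le_left))
  obtain ⟨n, hn⟩ := (hx.eventually (hLle.trans inf_le_right hmem)).exists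
  exact hn ⟨n, rfl⟩

theorem stmt5 (F : Filter X) :
    (∀ H : Filter X, Frechet H → Triangle F H) ↔ AlmostPrincipal F := by
  refine ⟨fun h => ?_, fun hF H hH => hF.triangle hH⟩
  by_contra hF
  exact not_triangle_avoidingFilter hF (h _ (frechet_avoidingFilter F))
end

section
/- A filter F on a set X is productively Fréchet (F ∈ F_ω^{△△}) if and only if both: (i) F ∈ F_ω^{△◊}, i.e., F ◊ G for every strongly Fréchet filter G on X; and (ii) F ∨ A is productively Fréchet for every countable subset A ⊆ X with A # F. -/
open Filter Set

variable {X : Type*}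

/-- The `◊` relation: `F ◊ H` iff whenever `H` meshes `F` there is a countable set
meshing with `F ∨ H` (i.e. `F ⊓ H`). -/
def Diamond (F H : Filter X) : Prop :=
  Mesh H F → ∃ A : Set X, A.Countable ∧ Mesh (𝓟 A) (F ⊓ H)

/-- Strongly Fréchet filters: `F △ H` for every proper countably based filter `H`. -/
def StronglyFrechet (F : Filter X) : Prop :=
  ∀ H : Filter X, H.NeBot → H.IsCountablyGenerated → Triangle F H

/-- Productively Fréchet filters: `F △ G` for every strongly Fréchet filter `G`. -/
def ProductivelyFrechet (F : Filter X) : Prop :=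
  ∀ G : Filter X, StronglyFrechet G → Triangle F G

theorem StronglyFrechet.inf_principal {G : Filter X} (hG : StronglyFrechet G) (A : Set X) :
    StronglyFrechet (G ⊓ 𝓟 A) := by
  intro H _ hHc hm
  have hm' : (H ⊓ 𝓟 A ⊓ G).NeBot := by
    rwa [inf_assoc, inf_comm (𝓟 A) G]
  have hne : (H ⊓ 𝓟 A).NeBot := hm'.mono inf_le_left
  obtain ⟨L, hL, hLc, hle⟩ := hG (H ⊓ 𝓟 A) hne inferInstance hm'
  refine ⟨L, hL, hLc, hle.trans_eq ?_⟩
  rw [inf_comm H, inf_assoc]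

theorem ProductivelyFrechet.inf_principal {F : Filter X} (hF : ProductivelyFrechet F)
    (A : Set X) : ProductivelyFrechet (F ⊓ 𝓟 A) := by
  intro G hG hm
  have hm' : (G ⊓ 𝓟 A ⊓ F).NeBot := by
    rwa [inf_assoc, inf_comm (𝓟 A) F]
  obtain ⟨L, hL, hLc, hle⟩ := hF (G ⊓ 𝓟 A) (hG.inf_principal A) hm'
  refine ⟨L, hL, hLc, hle.trans_eq ?_⟩
  rw [inf_comm G, inf_assoc]

theorem exists_countable_mesh_of_isCountablyGenerated (L : Filter X) [L.NeBot]
    [L.IsCountablyGenerated] : ∃ A : Set X, A.Countable ∧ Mesh (𝓟 A) L := by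
  obtain ⟨u, hu⟩ := exists_seq_tendsto L
  refine ⟨range u, countable_range u, ?_⟩
  have h : Tendsto u atTop (𝓟 (range u) ⊓ L) :=
    tendsto_inf.2 ⟨tendsto_principal.2 (Eventually.of_forall mem_range_self), hu⟩
  exact h.neBot

theorem Triangle.diamond {F G : Filter X} (h : Triangle F G) : Diamond F G := by
  intro hm
  obtain ⟨L, _, _, hle⟩ := h hm
  obtain ⟨A, hA, hAL⟩ := exists_countable_mesh_of_isCountablyGenerated L
  exact ⟨A, hA, NeBot.mono hAL (inf_le_inf_left _ hle)⟩

theorem stmt16 (F : Filter X) :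
    ProductivelyFrechet F ↔
      ((∀ G : Filter X, StronglyFrechet G → Diamond F G) ∧
        ∀ A : Set X, A.Countable → Mesh (𝓟 A) F → ProductivelyFrechet (F ⊓ 𝓟 A)) := by
  refine ⟨fun hF => ⟨fun G hG => (hF G hG).diamond, fun A _ _ => hF.inf_principal A⟩, ?_⟩
  rintro ⟨hD, hP⟩ G hG hm
  obtain ⟨A, hA, hAm⟩ := hD G hG hm
  have hAF : Mesh (𝓟 A) F := NeBot.mono hAm (inf_le_inf_left _ inf_le_left)
  have hGA : Mesh G (F ⊓ 𝓟 A) := by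
    have he : G ⊓ (F ⊓ 𝓟 A) = 𝓟 A ⊓ (F ⊓ G) := by ac_rfl
    rw [Mesh, he]
    exact hAm
  obtain ⟨L, hL, hLc, hle⟩ := hP A hA hAF G hG hGA
  exact ⟨L, hL, hLc, hle.trans (inf_le_inf_right _ inf_le_left)⟩
end

section
/- Let X be a topological space and x ∈ X a strongly q-regular point whose neighborhood filter N(x) is countably tight. Then x is a tight point of X. -/
open Filter Set

variable {X : Type*}

/-- Countably tight filters: whenever a set `A` meshes `F` there is a countable set
meshing with `F ∨ A` (i.e. `F ⊓ 𝓟 A` in Mathlib's order). -/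
def CountablyTight (F : Filter X) : Prop :=
  ∀ A : Set X, Mesh (𝓟 A) F → ∃ B : Set X, B.Countable ∧ Mesh (𝓟 B) (F ⊓ 𝓟 A)

/-- The set of cluster (adherent) points of a filter: points whose neighborhood filter
meshes it. -/
def adh [TopologicalSpace X] (H : Filter X) : Set X := {y | Mesh (nhds y) H}

/-- A point `x` is strongly `q`-regular if for every `F ∈ N(x)` there is a sequence
`(Qₙ)` of members of `N(x)` such that for every countable family of sequences in `X`
whose tail filters have infimum (the paper's `⋀`, Mathlib's `⨆`) meshing with the
filter generated by `{Qₙ : n ∈ ω}` (which is `⨅ n, 𝓟 (Q n)`), the set of adherent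
points of that infimum filter meets `F`. -/
def StronglyQRegular [TopologicalSpace X] (x : X) : Prop :=
  ∀ F ∈ nhds x, ∃ Q : ℕ → Set X, (∀ n, Q n ∈ nhds x) ∧
    ∀ xs : ℕ → ℕ → X,
      Mesh (⨆ i, Filter.map (xs i) Filter.atTop) (⨅ n, 𝓟 (Q n)) →
      (adh (⨆ i, Filter.map (xs i) Filter.atTop) ∩ F).Nonempty

/-- A collection `E` of subsets clusters at `p` if every neighborhood of `p` has
infinite intersection with some member of `E`. -/
def Clusters [TopologicalSpace X] (E : Set (Set X)) (p : X) : Prop :=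
  ∀ U ∈ nhds p, ∃ e ∈ E, (U ∩ e).Infinite

/-- `p` is a tight point if every collection clustering at `p` has a countable
subcollection clustering at `p`. -/
def TightPoint [TopologicalSpace X] (p : X) : Prop :=
  ∀ E : Set (Set X), Clusters E p → ∃ E' ⊆ E, E'.Countable ∧ Clusters E' p

/-- The filter generated by neighborhoods `Q n` of `x` meshes the infimum of the tail filters of
countably many injective sequences, each of them lying in a member of a family clustering at `x`. -/
theorem Clusters.exists_injective_seq_mesh [TopologicalSpace X] {E : Set (Set X)} {x : X}
    (hE : Clusters E x) {Q : ℕ → Set X} (hQ : ∀ n, Q n ∈ nhds x) :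
    ∃ (e : ℕ → Set X) (xs : ℕ → ℕ → X), (∀ i, e i ∈ E) ∧
      (∀ i, Function.Injective (xs i)) ∧ (∀ i k, xs i k ∈ e i) ∧
      Mesh (⨆ i, Filter.map (xs i) Filter.atTop) (⨅ n, 𝓟 (Q n)) := by
  have hR : ∀ n, (⋂ m ∈ Iic n, Q m) ∈ nhds x := fun n =>
    (biInter_mem (finite_Iic n)).2 fun m _ => hQ m
  choose e heE hinf using fun n => hE _ (hR n)
  refine ⟨e, fun i k => (hinf i).natEmbedding _ k, heE,
    fun i => Subtype.val_injective.comp ((hinf i).natEmbedding _).injective,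
    fun i k => ((hinf i).natEmbedding _ k).2.2, ?_⟩
  have hanti : Antitone fun n => 𝓟 (⋂ m ∈ Iic n, Q m) := fun a b hab =>
    principal_mono.2 (biInter_subset_biInter_left (Iic_subset_Iic.2 hab))
  have hle : ⨅ n, 𝓟 (⋂ m ∈ Iic n, Q m) ≤ ⨅ n, 𝓟 (Q n) :=
    iInf_mono fun n => principal_mono.2 (biInter_subset_of_mem self_mem_Iic)
  refine NeBot.mono (inf_neBot_iff.2 fun {s} hs {t} ht => ?_) (inf_le_inf_left _ hle)
  obtain ⟨n, hn⟩ := (mem_iInf_of_directed hanti.directed_ge _).1 ht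
  obtain ⟨k, hk⟩ := (mem_map.1 (mem_iSup.1 hs n) |> Filter.Eventually.exists)
  exact ⟨_, hk, hn ((hinf n).natEmbedding _ k).2.1⟩

/-- A neighborhood of an adherent point of an infimum of tail filters of injective sequences
contains infinitely many terms of one of them. -/
theorem exists_infinite_inter_of_mem_adh [TopologicalSpace X] {e : ℕ → Set X} {xs : ℕ → ℕ → X}
    (hinj : ∀ i, Function.Injective (xs i)) (hmem : ∀ i k, xs i k ∈ e i) {y : X}
    (hy : y ∈ adh (⨆ i, Filter.map (xs i) Filter.atTop)) {U : Set X} (hU : U ∈ nhds y) :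
    ∃ i, (U ∩ e i).Infinite := by
  by_contra! hfin
  have hc : Uᶜ ∈ ⨆ i, Filter.map (xs i) Filter.atTop := by
    refine mem_iSup.2 fun i => mem_map.2 ?_
    rw [← Nat.cofinite_eq_atTop, mem_cofinite]
    refine ((hfin i).preimage (hinj i).injOn).subset fun k hk => ?_
    exact ⟨not_not.1 hk, hmem i k⟩
  obtain ⟨z, hz, hz'⟩ := inf_neBot_iff.1 hy hU hc
  exact hz' hz

theorem stmt19 [TopologicalSpace X] (x : X)
    (hq : StronglyQRegular x) (ht : CountablyTight (nhds x)) :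
    TightPoint x := by
  intro E hE
  let A : Set X := {y | ∃ e : ℕ → Set X, (∀ i, e i ∈ E) ∧
    ∀ U ∈ nhds y, ∃ i, (U ∩ e i).Infinite}
  have hA : Mesh (𝓟 A) (nhds x) := by
    refine inf_neBot_iff.2 fun {s} hs {F} hF => ?_
    obtain ⟨Q, hQ, hadh⟩ := hq F hF
    obtain ⟨e, xs, heE, hinj, hmem, hmesh⟩ := hE.exists_injective_seq_mesh hQ
    obtain ⟨y, hy, hyF⟩ := hadh xs hmesh
    exact ⟨y, hs ⟨e, heE, fun U hU => exists_infinite_inter_of_mem_adh hinj hmem hy hU⟩, hyF⟩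
  obtain ⟨B, hB, hBA⟩ := ht A hA
  choose! e heE he using fun (y : X) (hy : y ∈ A) => hy
  refine ⟨⋃ y ∈ B ∩ A, range (e y), ?_, ?_, ?_⟩
  · exact iUnion₂_subset fun y hy => range_subset_iff.2 (heE y hy.2)
  · exact (hB.mono inter_subset_left).biUnion fun y _ => countable_range _
  · intro U hU
    obtain ⟨y, hyB, hyU, hyA⟩ := inf_neBot_iff.1 hBA (mem_principal_self B)
      (inter_mem_inf (interior_mem_nhds.2 hU) (mem_principal_self A))
    obtain ⟨i, hi⟩ := he y hyA U (mem_interior_iff_mem_nhds.1 hyU)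
    exact ⟨e y i, mem_biUnion (⟨hyB, hyA⟩ : y ∈ B ∩ A) (mem_range_self i), hi⟩
end
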